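/- Suppose there exists an (n₁, r₁, s₁)-system H₁ with α(H₁) < n₁/f and an (n₂, r₂, s₂)-system H₂ with α(H₂) < n₂/g, where f ≥ 1 and g > 1 are real numbers. Set t = ⌈ log(n₁^{r₁−1} · f / r₁!) / log g ⌉ and h = (f/2)^{1/t}. Then there exists an (n₁·n₂, r₁·r₂, max{r₁(s₂−1)+1, r₂(s₁−1)+1})-system with independence number strictly less than n₁·n₂ / h. -/

import Mathlib

/-- `H` is an `(r,s)`-system (design) on vertex type `V`: every edge has `r` vertices and
every pair of distinct edges intersects in fewer than `s` vertices. -/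
def IsDesign {V : Type*} [DecidableEq V] (r s : ℕ) (H : Finset (Finset V)) : Prop :=
  (∀ e ∈ H, e.card = r) ∧ ∀ e ∈ H, ∀ f ∈ H, e ≠ f → (e ∩ f).card < s

/-- The independence number of `H` is (strictly) less than `x`. -/
def IndepLT {V : Type*} (H : Finset (Finset V)) (x : ℝ) : Prop :=
  ∀ S : Finset V, (∀ e ∈ H, ¬ e ⊆ S) → (S.card : ℝ) < x

open Finset in
/-- Deletion: a set has fewer than `x` plus (number of contained edges) vertices. -/
theorem deletion_bound {V : Type*} [DecidableEq V] [Nonempty V] (H : Finset (Finset V)) (x : ℝ)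
    (hH : IndepLT H x) (hne : ∀ e ∈ H, e.Nonempty) (T : Finset V) :
    (T.card : ℝ) < x + ((H.filter (fun e => e ⊆ T)).card : ℝ) := by
  classical
  choose! c hc using hne
  have hlt := hH (T \ (H.filter (fun e => e ⊆ T)).image c) (by
    intro e he hsub
    have h1 := hsub (hc e he)
    rw [mem_sdiff] at h1
    apply h1.2
    rw [mem_image]
    exact ⟨e, mem_filter.2 ⟨he, fun y hy => (mem_sdiff.1 (hsub hy)).1⟩, rfl⟩)
  have h2 := le_card_sdiff ((H.filter (fun e => e ⊆ T)).image c) T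
  have h3 : ((H.filter (fun e => e ⊆ T)).image c).card ≤ (H.filter (fun e => e ⊆ T)).card :=
    card_image_le
  have h4 : T.card ≤ (T \ (H.filter (fun e => e ⊆ T)).image c).card
      + (H.filter (fun e => e ⊆ T)).card := by omega
  have h5 : (T.card : ℝ) ≤ ((T \ (H.filter (fun e => e ⊆ T)).image c).card : ℝ)
      + ((H.filter (fun e => e ⊆ T)).card : ℝ) := by exact_mod_cast h4
  linarith

open Finset in
/-- Number of maps `Fin k → W` with all values in `A`. -/
theorem card_maps_into {W : Type*} [Fintype W] [DecidableEq W] (k : ℕ) (A : Finset W) :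
    ((univ : Finset (Fin k → W)).filter (fun x => ∀ i, x i ∈ A)).card = A.card ^ k := by
  have : (univ : Finset (Fin k → W)).filter (fun x => ∀ i, x i ∈ A)
      = Fintype.piFinset (fun _ : Fin k => A) := by
    ext x; simp [Fintype.mem_piFinset]
  rw [this, Fintype.card_piFinset]
  simp

open Finset in
/-- Dependent random choice for the product of two hypergraphs. -/
theorem core_bound {V W : Type*} [Fintype V] [DecidableEq V] [Fintype W] [DecidableEq W]
    [Nonempty V] [Nonempty W]
    (H₁ : Finset (Finset V)) (H₂ : Finset (Finset W)) (f g h : ℝ) (k : ℕ) (hk : 1 ≤ k)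
    (hf : 1 ≤ f) (hg : 1 < g) (hh : 0 < h) (hhk : h ^ k = f / 2)
    (hne : ∀ e ∈ H₁, e.Nonempty)
    (hα₁ : IndepLT H₁ ((Fintype.card V : ℝ) / f)) (hα₂ : IndepLT H₂ ((Fintype.card W : ℝ) / g))
    (hcount : (H₁.card : ℝ) ≤ (Fintype.card V : ℝ) / f * g ^ k)
    (S : Finset (V × W)) (hS : ∀ e ∈ H₁, ∀ e' ∈ H₂, ¬ e ×ˢ e' ⊆ S) :
    (S.card : ℝ) < (Fintype.card V : ℝ) * (Fintype.card W : ℝ) / h := by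
  classical
  by_contra hcon
  rw [not_lt] at hcon
  set n₁ : ℝ := (Fintype.card V : ℝ) with hn₁
  set n₂ : ℝ := (Fintype.card W : ℝ) with hn₂
  have hn₁0 : 0 < n₁ := by rw [hn₁]; exact_mod_cast Fintype.card_pos
  have hn₂0 : 0 < n₂ := by rw [hn₂]; exact_mod_cast Fintype.card_pos
  have hf0 : 0 < f := by linarith
  have hg0 : 0 < g := by linarith
  let N : V → Finset W := fun v => univ.filter (fun w => (v, w) ∈ S)
  let T : (Fin k → W) → Finset V := fun x => univ.filter (fun v => ∀ i, x i ∈ N v)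
  let C : Finset V → Finset W := fun e => univ.filter (fun w => ∀ v ∈ e, (v, w) ∈ S)
  have hScard : (S.card : ℝ) = ∑ v, ((N v).card : ℝ) := by
    have : S.card = ∑ v, (N v).card := by
      rw [card_eq_sum_card_fiberwise (f := Prod.fst) (t := univ) (by simp)]
      refine sum_congr rfl fun v _ => ?_
      refine card_bij' (fun p _ => p.2) (fun w _ => (v, w)) ?_ ?_ ?_ ?_
      · rintro ⟨a, b⟩ hab
        simp only [mem_filter] at hab
        obtain ⟨h1, rfl⟩ := hab
        simpa [N] using h1
      · intro w hw
        simpa [N] using hw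
      · rintro ⟨a, b⟩ hab
        simp only [mem_filter] at hab
        simp [hab.2]
      · intro w hw
        rfl
    exact_mod_cast this
  have hTsum : ∑ x, ((T x).card : ℝ) = ∑ v, ((N v).card : ℝ) ^ k := by
    have : ∑ x, (T x).card = ∑ v, (N v).card ^ k := by
      simp_rw [← card_maps_into k, T]
      exact sum_card_bipartiteAbove_eq_sum_card_bipartiteBelow (s := univ) (t := univ)
        (fun (x : Fin k → W) (v : V) => ∀ i, x i ∈ N v)
    exact_mod_cast this
  have hEsum : ∑ x, ((H₁.filter (fun e => e ⊆ T x)).card : ℝ) = ∑ e ∈ H₁, ((C e).card : ℝ) ^ k := by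
    have : ∑ x, (H₁.filter (fun e => e ⊆ T x)).card = ∑ e ∈ H₁, (C e).card ^ k := by
      simp_rw [← card_maps_into k]
      have h1 := sum_card_bipartiteAbove_eq_sum_card_bipartiteBelow (s := univ) (t := H₁)
        (fun (x : Fin k → W) (e : Finset V) => e ⊆ T x)
      simp only [bipartiteAbove, bipartiteBelow] at h1
      rw [h1]
      refine sum_congr rfl fun e _ => ?_
      congr 1
      ext x
      simp only [mem_filter, mem_univ, true_and, T, C, N, subset_iff]
      exact ⟨fun h i v hv => h hv i, fun h v hv i => h i v hv⟩
    exact_mod_cast this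
  have hlow : n₁ * n₂ ^ k * (2 / f) ≤ ∑ v, ((N v).card : ℝ) ^ k := by
    obtain ⟨m, rfl⟩ : ∃ m, k = m + 1 := ⟨k - 1, by omega⟩
    have hp := pow_sum_div_card_le_sum_pow (s := (univ : Finset V))
      (f := fun v => ((N v).card : ℝ)) (fun v _ => Nat.cast_nonneg _) m
    rw [← hScard] at hp
    refine le_trans ?_ hp
    rw [card_univ, ← hn₁, le_div_iff₀ (by positivity)]
    calc n₁ * n₂ ^ (m + 1) * (2 / f) * n₁ ^ m = (n₁ * n₂ / h) ^ (m + 1) := by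
          rw [div_pow, hhk]; field_simp
          ring
      _ ≤ _ := pow_le_pow_left₀ (by positivity) hcon _
  have hup : ∑ e ∈ H₁, ((C e).card : ℝ) ^ k ≤ n₁ / f * n₂ ^ k := by
    calc ∑ e ∈ H₁, ((C e).card : ℝ) ^ k ≤ ∑ e ∈ H₁, (n₂ / g) ^ k := by
          refine sum_le_sum fun e he => pow_le_pow_left₀ (Nat.cast_nonneg _) (le_of_lt ?_) _
          refine hα₂ (C e) fun e' he' hsub => hS e he e' he' ?_
          rintro ⟨a, b⟩ hab
          rw [mem_product] at hab
          exact (mem_filter.1 (hsub hab.2)).2 a hab.1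
      _ = H₁.card * (n₂ / g) ^ k := by simp
      _ ≤ (n₁ / f * g ^ k) * (n₂ / g) ^ k := by gcongr
      _ = n₁ / f * n₂ ^ k := by rw [div_pow]; field_simp
  have hdel : ∑ x, ((T x).card : ℝ)
      < ∑ x, (n₁ / f + ((H₁.filter (fun e => e ⊆ T x)).card : ℝ)) :=
    sum_lt_sum_of_nonempty univ_nonempty fun x _ => deletion_bound H₁ _ hα₁ hne (T x)
  rw [sum_add_distrib, hEsum, hTsum] at hdel
  have hc : ∑ x : Fin k → W, n₁ / f = n₁ / f * n₂ ^ k := by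
    simp [hn₂, mul_comm]
  rw [hc] at hdel
  have : n₁ * n₂ ^ k * (2 / f) = n₁ / f * n₂ ^ k + n₁ / f * n₂ ^ k := by ring
  linarith

/-- `r! ≤ r ^ (r - 1)`. -/
theorem factorial_le_pow_pred (m : ℕ) : (m + 1).factorial ≤ (m + 1) ^ m := by
  induction m with
  | zero => simp
  | succ m ih =>
    rw [Nat.factorial_succ, pow_succ, mul_comm]
    exact Nat.mul_le_mul (ih.trans (Nat.pow_le_pow_left (by omega) _)) le_rfl

theorem stmt14 (n₁ n₂ r₁ r₂ s₁ s₂ : ℕ) (hs₁ : 1 ≤ s₁) (hs₂ : 1 ≤ s₂)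
    (f g : ℝ) (hf : 1 ≤ f) (hg : 1 < g)
    (H₁ : Finset (Finset (Fin n₁))) (H₂ : Finset (Finset (Fin n₂)))
    (h₁ : IsDesign r₁ s₁ H₁) (h₂ : IsDesign r₂ s₂ H₂)
    (hα₁ : IndepLT H₁ ((n₁ : ℝ) / f)) (hα₂ : IndepLT H₂ ((n₂ : ℝ) / g)) :
    ∀ t : ℤ, t = ⌈Real.log ((n₁ : ℝ) ^ (r₁ - 1) * f / (Nat.factorial r₁ : ℝ)) / Real.log g⌉ →
    ∀ h : ℝ, h = (f / 2) ^ ((1 : ℝ) / (t : ℝ)) →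
      ∃ H : Finset (Finset (Fin (n₁ * n₂))),
        IsDesign (r₁ * r₂) (max (r₁ * (s₂ - 1) + 1) (r₂ * (s₁ - 1) + 1)) H ∧
        IndepLT H ((n₁ : ℝ) * (n₂ : ℝ) / h) := by
  intro t ht h hh
  classical
  have hf0 : 0 < f := by linarith
  have hg0 : 0 < g := by linarith
  have hH₁ : H₁.Nonempty := by
    by_contra hc
    rw [Finset.not_nonempty_iff_eq_empty] at hc
    have h3 := hα₁ Finset.univ (by simp [hc])
    rw [Finset.card_univ, Fintype.card_fin] at h3
    exact absurd h3 (not_lt.2 (div_le_self (Nat.cast_nonneg _) hf))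
  have hH₂ : H₂.Nonempty := by
    by_contra hc
    rw [Finset.not_nonempty_iff_eq_empty] at hc
    have h3 := hα₂ Finset.univ (by simp [hc])
    rw [Finset.card_univ, Fintype.card_fin] at h3
    exact absurd h3 (not_lt.2 (div_le_self (Nat.cast_nonneg _) hg.le))
  obtain ⟨a, ha⟩ := hH₁
  obtain ⟨b, hb⟩ := hH₂
  let φ : Fin n₁ × Fin n₂ ↪ Fin (n₁ * n₂) := finProdFinEquiv.toEmbedding
  refine ⟨(H₁ ×ˢ H₂).image (fun p => (p.1 ×ˢ p.2).map φ), ⟨?_, ?_⟩, ?_⟩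
  · intro e he
    obtain ⟨⟨p, q⟩, hpq, rfl⟩ := Finset.mem_image.1 he
    rw [Finset.mem_product] at hpq
    rw [Finset.card_map, Finset.card_product, h₁.1 _ hpq.1, h₂.1 _ hpq.2]
  · intro e he e' he' hne
    obtain ⟨⟨p, q⟩, hpq, rfl⟩ := Finset.mem_image.1 he
    obtain ⟨⟨p', q'⟩, hpq', rfl⟩ := Finset.mem_image.1 he'
    rw [Finset.mem_product] at hpq hpq'
    simp only at hpq hpq' hne ⊢
    rw [← Finset.map_inter, Finset.card_map, Finset.product_inter_product, Finset.card_product]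
    by_cases hq : q = q'
    · have hp : p ≠ p' := by
        rintro rfl
        exact hne (by rw [hq])
      have h3 := h₁.2 _ hpq.1 _ hpq'.1 hp
      have h4 : (q ∩ q').card ≤ r₂ := by
        rw [← h₂.1 _ hpq.2]; exact Finset.card_le_card Finset.inter_subset_left
      refine lt_max_of_lt_right (Nat.lt_succ_of_le ?_)
      rw [mul_comm]
      exact Nat.mul_le_mul h4 (by omega)
    · have h3 := h₂.2 _ hpq.2 _ hpq'.2 hq
      have h4 : (p ∩ p').card ≤ r₁ := by
        rw [← h₁.1 _ hpq.1]; exact Finset.card_le_card Finset.inter_subset_left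
      refine lt_max_of_lt_left (Nat.lt_succ_of_le ?_)
      exact Nat.mul_le_mul h4 (by omega)
  intro S hS
  -- pull back to the product
  let S' : Finset (Fin n₁ × Fin n₂) := S.map finProdFinEquiv.symm.toEmbedding
  have hS'card : S'.card = S.card := Finset.card_map _
  have hS' : ∀ e ∈ H₁, ∀ e' ∈ H₂, ¬ e ×ˢ e' ⊆ S' := by
    intro e he e' he' hsub
    refine hS _ (Finset.mem_image.2 ⟨(e, e'), Finset.mem_product.2 ⟨he, he'⟩, rfl⟩) ?_
    intro y hy
    obtain ⟨z, hz, rfl⟩ := Finset.mem_map.1 hy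
    obtain ⟨w, hw, hwz⟩ := Finset.mem_map.1 (hsub hz)
    have : φ z = w := by
      rw [← hwz]; exact finProdFinEquiv.apply_symm_apply w
    rw [this]; exact hw
  rw [← hS'card]
  have hprod0 : (a ×ˢ b).Nonempty := by
    by_contra hc
    rw [Finset.not_nonempty_iff_eq_empty] at hc
    exact hS' a ha b hb (by rw [hc]; exact Finset.empty_subset _)
  obtain ⟨⟨v, w⟩, hvw⟩ := hprod0
  rw [Finset.mem_product] at hvw
  have hr₁ : 1 ≤ r₁ := by
    rw [← h₁.1 a ha]; exact Finset.card_pos.2 ⟨v, hvw.1⟩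
  have : Nonempty (Fin n₁) := ⟨v⟩
  have : Nonempty (Fin n₂) := ⟨w⟩
  have hrn : r₁ ≤ n₁ := by
    rw [← h₁.1 a ha]; simpa using Finset.card_le_univ a
  have hn0 : 0 < n₁ := by omega
  set X : ℝ := (n₁ : ℝ) ^ (r₁ - 1) * f / (Nat.factorial r₁ : ℝ) with hX
  have hfac0 : (0 : ℝ) < (Nat.factorial r₁ : ℝ) := by exact_mod_cast Nat.factorial_pos _
  have hfac : (Nat.factorial r₁ : ℝ) ≤ (n₁ : ℝ) ^ (r₁ - 1) := by
    have h3 := factorial_le_pow_pred (r₁ - 1)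
    rw [Nat.sub_add_cancel hr₁] at h3
    exact_mod_cast h3.trans (Nat.pow_le_pow_left hrn _)
  have hX1 : 1 ≤ X := by
    rw [hX, le_div_iff₀ hfac0, one_mul]
    exact hfac.trans (le_mul_of_one_le_right (by positivity) hf)
  have hlogg : 0 < Real.log g := Real.log_pos hg
  have ht0 : 0 ≤ t := by
    rw [ht]
    exact Int.ceil_nonneg (div_nonneg (Real.log_nonneg hX1) hlogg.le)
  obtain ⟨k, rfl⟩ := Int.eq_ofNat_of_zero_le ht0
  rcases Nat.eq_zero_or_pos k with hk | hk
  · have h1 : h = 1 := by rw [hh, hk]; simp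
    rw [h1, div_one]
    have hlt : S'.card < n₁ * n₂ := by
      have h3 : S'.card < Fintype.card (Fin n₁ × Fin n₂) := by
        apply (Finset.card_lt_iff_ne_univ _).2
        intro hc
        exact hS' a ha b hb (by rw [hc]; exact Finset.subset_univ _)
      simpa using h3
    exact_mod_cast hlt
  · have hXg : X ≤ g ^ k := by
      have h3 := Int.le_ceil (Real.log X / Real.log g)
      rw [← ht, div_le_iff₀ hlogg] at h3
      have h4 : Real.log X ≤ Real.log (g ^ k) := by
        rw [Real.log_pow]; simpa using h3
      exact (Real.log_le_log_iff (by linarith) (by positivity)).1 h4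
    have hhk : h ^ k = f / 2 := by
      have h3 := Real.rpow_inv_natCast_pow (x := f / 2) (by positivity) (n := k) (by omega)
      rw [hh]
      simpa using h3
    have hh0 : 0 < h := by rw [hh]; positivity
    have hcount : (H₁.card : ℝ) ≤ (n₁ : ℝ) / f * g ^ k := by
      have h3 : H₁.card ≤ n₁.choose r₁ := by
        have h4 : H₁ ⊆ Finset.powersetCard r₁ Finset.univ := fun e he =>
          Finset.mem_powersetCard.2 ⟨Finset.subset_univ _, h₁.1 e he⟩
        simpa using Finset.card_le_card h4
      calc (H₁.card : ℝ) ≤ (n₁.choose r₁ : ℝ) := by exact_mod_cast h3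
        _ ≤ (n₁ : ℝ) ^ r₁ / (Nat.factorial r₁ : ℝ) := Nat.choose_le_pow_div _ _
        _ = (n₁ : ℝ) / f * X := by
          rw [hX]
          conv_lhs => rw [← Nat.sub_add_cancel hr₁, pow_succ]
          rw [Nat.sub_add_cancel hr₁]
          field_simp
        _ ≤ _ := by gcongr
    have h3 := core_bound H₁ H₂ f g h k hk hf hg hh0 hhk
      (fun e he => Finset.card_pos.1 (by rw [h₁.1 e he]; exact hr₁))
      (by simpa using hα₁) (by simpa using hα₂) (by simpa using hcount) S' hS'
    simpa using h3
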